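/- arXiv:2305.19173 — 2 statements merged into one kernel-verified Lean document; each statement's English description precedes it below -/
import Mathlib

section
/- For all β > 0, 𝔞 > 0 and ρ₀ > 0, the nonnegative function p ↦ 16π𝔞ρ₀/|p|² − ln(1 + 16π𝔞ρ₀/|p|²) is integrable on ℝ³ and (1/(2β(2π)³)) · ∫_{ℝ³} [ 16π𝔞ρ₀/|p|² − ln(1 + 16π𝔞ρ₀/|p|²) ] dp = (16√π/(3β)) · (𝔞ρ₀)^{3/2}. Equivalently, for every c > 0 one has ∫_{ℝ³} ( c/|p|² − ln(1 + c/|p|²) ) dp = (4π²/3) · c^{3/2}. -/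
open MeasureTheory

lemma aux_log_le (c r : ℝ) (hc : 0 < c) : Real.log (1 + c / r ^ 2) ≤ c / r ^ 2 := by
  have h : 0 ≤ c / r ^ 2 := by positivity
  have := Real.log_le_sub_one_of_pos (x := 1 + c / r ^ 2) (by linarith)
  linarith

lemma aux_log_nonneg (c r : ℝ) (hc : 0 < c) : 0 ≤ Real.log (1 + c / r ^ 2) := by
  have h : 0 ≤ c / r ^ 2 := by positivity
  exact Real.log_nonneg (by linarith)

noncomputable def auxG (s r : ℝ) : ℝ :=
  (s ^ 2 * r - r ^ 3 * Real.log (1 + s ^ 2 / r ^ 2)) / 3 + 2 * s ^ 3 / 3 * Real.arctan (r / s)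

lemma auxG_deriv (s r : ℝ) (hs : 0 < s) (hr : 0 < r) :
    HasDerivAt (auxG s) (r ^ 2 * (s ^ 2 / r ^ 2 - Real.log (1 + s ^ 2 / r ^ 2))) r := by
  have hp : HasDerivAt (fun r : ℝ => r ^ 2) (2 * r) r := by
    simpa using hasDerivAt_pow 2 r
  have hp3 : HasDerivAt (fun r : ℝ => r ^ 3) (3 * r ^ 2) r := by
    simpa using hasDerivAt_pow 3 r
  have h1 : HasDerivAt (fun r : ℝ => 1 + s ^ 2 / r ^ 2)
      ((0 * r ^ 2 - s ^ 2 * (2 * r)) / (r ^ 2) ^ 2) r :=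
    ((hasDerivAt_const r (s ^ 2)).div hp (by positivity)).const_add 1
  have h2 := h1.log (by positivity)
  have h3 := hp3.mul h2
  have h4 := (((hasDerivAt_id r).const_mul (s ^ 2)).sub h3).div_const 3
  have h5 := (((hasDerivAt_id r).div_const s).arctan).const_mul (2 * s ^ 3 / 3)
  have h6 := h4.add h5
  refine HasDerivAt.congr_deriv (f := auxG s) h6 ?_
  simp only [id]
  have : 0 < r ^ 2 + s ^ 2 := by positivity
  field_simp
  ring

lemma auxG_cont (s : ℝ) (hs : 0 < s) : ContinuousWithinAt (auxG s) (Set.Ici 0) 0 := by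
  have hl : Filter.Tendsto (fun r : ℝ => r ^ 3 * Real.log (1 + s ^ 2 / r ^ 2))
      (nhdsWithin 0 (Set.Ici 0)) (nhds 0) := by
    have hu : Filter.Tendsto (fun r : ℝ => s ^ 2 * r) (nhdsWithin 0 (Set.Ici 0)) (nhds 0) := by
      have : Continuous (fun r : ℝ => s ^ 2 * r) := by fun_prop
      have := this.tendsto 0
      rw [mul_zero] at this
      exact this.mono_left nhdsWithin_le_nhds
    refine tendsto_of_tendsto_of_tendsto_of_le_of_le' tendsto_const_nhds hu ?_ ?_
    · filter_upwards [self_mem_nhdsWithin] with r hr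
      have hr : 0 ≤ r := hr
      exact mul_nonneg (by positivity) (aux_log_nonneg _ _ (by positivity))
    · filter_upwards [self_mem_nhdsWithin] with r hr
      have hr : 0 ≤ r := hr
      calc _ ≤ r ^ 3 * (s ^ 2 / r ^ 2) :=
            mul_le_mul_of_nonneg_left (aux_log_le _ _ (by positivity)) (by positivity)
        _ = s ^ 2 * r := by
            rcases hr.eq_or_lt with h | h
            · subst h; simp
            · field_simp
  have hl' : ContinuousWithinAt (fun r : ℝ => r ^ 3 * Real.log (1 + s ^ 2 / r ^ 2))
      (Set.Ici 0) 0 := by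
    simpa [ContinuousWithinAt] using hl
  have h1 : ContinuousWithinAt (fun r : ℝ => s ^ 2 * r) (Set.Ici 0) 0 := by fun_prop
  have h2 : ContinuousWithinAt (fun r : ℝ => 2 * s ^ 3 / 3 * Real.arctan (r / s))
      (Set.Ici 0) 0 :=
    (continuous_const.mul
      (Real.continuous_arctan.comp (continuous_id.div_const s))).continuousWithinAt
  exact ((h1.sub hl').div_const 3).add h2

lemma auxG_lim (s : ℝ) (hs : 0 < s) :
    Filter.Tendsto (auxG s) Filter.atTop (nhds (Real.pi * s ^ 3 / 3)) := by
  have h1 : Filter.Tendsto (fun r : ℝ => s ^ 2 * r - r ^ 3 * Real.log (1 + s ^ 2 / r ^ 2))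
      Filter.atTop (nhds 0) := by
    have hu : Filter.Tendsto (fun r : ℝ => s ^ 4 / r) Filter.atTop (nhds 0) :=
      tendsto_const_nhds.div_atTop Filter.tendsto_id
    refine tendsto_of_tendsto_of_tendsto_of_le_of_le' tendsto_const_nhds hu ?_ ?_
    · filter_upwards [Filter.eventually_gt_atTop 0] with r hr
      have := mul_le_mul_of_nonneg_left (aux_log_le (s ^ 2) r (by positivity))
        (by positivity : 0 ≤ r ^ 3)
      have e : r ^ 3 * (s ^ 2 / r ^ 2) = s ^ 2 * r := by field_simp
      linarith
    · filter_upwards [Filter.eventually_gt_atTop 0] with r hr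
      have h := Real.one_sub_inv_le_log_of_pos (x := 1 + s ^ 2 / r ^ 2) (by positivity)
      have h := mul_le_mul_of_nonneg_left h (by positivity : 0 ≤ r ^ 3)
      have e : s ^ 2 * r - r ^ 3 * (1 - (1 + s ^ 2 / r ^ 2)⁻¹) = s ^ 4 * r / (r ^ 2 + s ^ 2) := by
        have : 0 < r ^ 2 + s ^ 2 := by positivity
        field_simp
        ring
      have e2 : s ^ 4 * r / (r ^ 2 + s ^ 2) ≤ s ^ 4 / r := by
        rw [div_le_div_iff₀ (by positivity) hr]
        nlinarith [show 0 < s ^ 4 * s ^ 2 by positivity]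
      linarith
  have h2 : Filter.Tendsto (fun r : ℝ => Real.arctan (r / s)) Filter.atTop
      (nhds (Real.pi / 2)) :=
    (Real.tendsto_arctan_atTop.mono_right nhdsWithin_le_nhds).comp
      (Filter.tendsto_id.atTop_div_const hs)
  have h3 := (h1.div_const 3).add (h2.const_mul (2 * s ^ 3 / 3))
  have e : (0 : ℝ) / 3 + 2 * s ^ 3 / 3 * (Real.pi / 2) = Real.pi * s ^ 3 / 3 := by ring
  rw [e] at h3
  exact h3

lemma aux_nonneg (c r : ℝ) (hc : 0 < c) : 0 ≤ c / r ^ 2 - Real.log (1 + c / r ^ 2) :=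
  sub_nonneg.2 (aux_log_le c r hc)

lemma aux_integrable (c : ℝ) (hc : 0 < c) :
    Integrable (fun p : EuclideanSpace ℝ (Fin 3) =>
      c / ‖p‖ ^ 2 - Real.log (1 + c / ‖p‖ ^ 2)) := by
  obtain ⟨s, hs, rfl⟩ : ∃ s : ℝ, 0 < s ∧ s ^ 2 = c :=
    ⟨Real.sqrt c, Real.sqrt_pos.2 hc, Real.sq_sqrt hc.le⟩
  have := (integrable_fun_norm_addHaar (volume : Measure (EuclideanSpace ℝ (Fin 3)))
    (f := fun r : ℝ => s ^ 2 / r ^ 2 - Real.log (1 + s ^ 2 / r ^ 2))).2 (by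
      simp only [finrank_euclideanSpace, Fintype.card_fin, smul_eq_mul]
      exact integrableOn_Ioi_deriv_of_nonneg (auxG_cont s hs)
        (fun r hr => auxG_deriv s r hs hr)
        (fun r _ => mul_nonneg (sq_nonneg r) (aux_nonneg _ _ hc)) (auxG_lim s hs))
  exact this

lemma aux_integral (c : ℝ) (hc : 0 < c) :
    ∫ p : EuclideanSpace ℝ (Fin 3), (c / ‖p‖ ^ 2 - Real.log (1 + c / ‖p‖ ^ 2))
      = (4 * Real.pi ^ 2 / 3) * c ^ ((3 : ℝ) / 2) := by
  obtain ⟨s, hs, rfl⟩ : ∃ s : ℝ, 0 < s ∧ s ^ 2 = c :=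
    ⟨Real.sqrt c, Real.sqrt_pos.2 hc, Real.sq_sqrt hc.le⟩
  have h := integral_fun_norm_addHaar (volume : Measure (EuclideanSpace ℝ (Fin 3)))
    (fun r : ℝ => s ^ 2 / r ^ 2 - Real.log (1 + s ^ 2 / r ^ 2))
  have hI := integral_Ioi_of_hasDerivAt_of_nonneg (auxG_cont s hs)
        (fun r hr => auxG_deriv s r hs hr)
        (fun r _ => mul_nonneg (by positivity) (aux_nonneg _ _ hc)) (auxG_lim s hs)
  rw [h]
  simp only [finrank_euclideanSpace, Fintype.card_fin, smul_eq_mul, nsmul_eq_mul]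
  have e : (3 - 1 : ℕ) = 2 := rfl
  rw [e, hI, measureReal_def, EuclideanSpace.volume_ball_fin_three]
  have e2 : (s ^ 2) ^ ((3 : ℝ) / 2) = s ^ 3 := by
    rw [← Real.rpow_natCast s 2, ← Real.rpow_mul hs.le, ← Real.rpow_natCast s 3]
    norm_num
  have e3 : auxG s 0 = 0 := by simp [auxG]
  rw [e2, e3]
  have e4 : (ENNReal.ofReal (1:ℝ) ^ 3 * ENNReal.ofReal (Real.pi * 4 / 3)).toReal
      = Real.pi * 4 / 3 := by
    rw [ENNReal.ofReal_one, one_pow, one_mul, ENNReal.toReal_ofReal (by positivity)]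
  rw [e4]
  push_cast
  ring

theorem stmt_1 :
    (∀ β 𝔞 ρ₀ : ℝ, 0 < β → 0 < 𝔞 → 0 < ρ₀ →
      (∀ p : EuclideanSpace ℝ (Fin 3),
        0 ≤ 16 * Real.pi * 𝔞 * ρ₀ / ‖p‖ ^ 2
            - Real.log (1 + 16 * Real.pi * 𝔞 * ρ₀ / ‖p‖ ^ 2)) ∧
      Integrable (fun p : EuclideanSpace ℝ (Fin 3) =>
        16 * Real.pi * 𝔞 * ρ₀ / ‖p‖ ^ 2
          - Real.log (1 + 16 * Real.pi * 𝔞 * ρ₀ / ‖p‖ ^ 2)) ∧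
      (1 / (2 * β * (2 * Real.pi) ^ 3)) *
          ∫ p : EuclideanSpace ℝ (Fin 3),
            (16 * Real.pi * 𝔞 * ρ₀ / ‖p‖ ^ 2
              - Real.log (1 + 16 * Real.pi * 𝔞 * ρ₀ / ‖p‖ ^ 2))
        = (16 * Real.sqrt Real.pi / (3 * β)) * (𝔞 * ρ₀) ^ ((3 : ℝ) / 2)) ∧
    (∀ c : ℝ, 0 < c →
      ∫ p : EuclideanSpace ℝ (Fin 3), (c / ‖p‖ ^ 2 - Real.log (1 + c / ‖p‖ ^ 2))
        = (4 * Real.pi ^ 2 / 3) * c ^ ((3 : ℝ) / 2)) := by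
  refine ⟨fun β a ρ hβ ha hρ => ?_, aux_integral⟩
  have hc : 0 < 16 * Real.pi * a * ρ := by positivity
  refine ⟨fun p => aux_nonneg _ _ hc, aux_integrable _ hc, ?_⟩
  rw [aux_integral _ hc]
  have e1 : (16 * Real.pi * a * ρ) ^ ((3 : ℝ) / 2)
      = 64 * (Real.pi * Real.sqrt Real.pi) * (a * ρ) ^ ((3 : ℝ) / 2) := by
    rw [show 16 * Real.pi * a * ρ = (16 * Real.pi) * (a * ρ) by ring,
      Real.mul_rpow (by positivity) (by positivity),
      Real.mul_rpow (by positivity) (by positivity)]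
    have h16 : (16 : ℝ) ^ ((3 : ℝ) / 2) = 64 := by
      rw [show (16 : ℝ) = 4 ^ (2 : ℝ) by norm_num, ← Real.rpow_mul (by norm_num)]
      norm_num
    have hpi : Real.pi ^ ((3 : ℝ) / 2) = Real.pi * Real.sqrt Real.pi := by
      rw [show (3 : ℝ) / 2 = 1 + 1 / 2 by norm_num, Real.rpow_add Real.pi_pos, Real.rpow_one,
        Real.sqrt_eq_rpow]
    rw [h16, hpi]
  rw [e1]
  have := Real.pi_pos
  field_simp
  ring
end

section
/- There exists a universal constant C > 0 such that for every finite set S ⊂ ℝ³ \ {0} and every α ≥ 0: Σ_{p∈S} ln(1 − exp(−|p|·√(|p|² + α))) ≤ Σ_{p∈S} ln(1 − exp(−|p|²)) + (α/2)·Σ_{p∈S} 1/(exp(|p|²) − 1) − (1/2)·Σ_{p∈S} [ α/|p|² − ln(1 + α/|p|²) ] + C·α²·Σ_{p∈S} 1/|p|². -/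
theorem aux_secant {x t : ℝ} (hx : 0 < x) (ht : x ≤ t) :
    (Real.exp t - 1)⁻¹ ≤ x * (Real.exp x - 1)⁻¹ * t⁻¹ := by
  have ht0 : 0 < t := hx.trans_le ht
  have h := convexOn_exp.secant_mono (a := 0) (x := x) (y := t) (Set.mem_univ _) (Set.mem_univ _)
    (Set.mem_univ _) hx.ne' ht0.ne' ht
  simp only [Real.exp_zero, sub_zero] at h
  have hex : 0 < Real.exp x - 1 := by linarith [Real.add_one_lt_exp hx.ne']
  have het : 0 < Real.exp t - 1 := by linarith [Real.add_one_lt_exp ht0.ne']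
  rw [div_le_div_iff₀ hx ht0] at h
  have : x * (Real.exp x - 1)⁻¹ * t⁻¹ = x / ((Real.exp x - 1) * t) := by
    field_simp
  rw [this, inv_eq_one_div, div_le_div_iff₀ het (by positivity)]
  linarith

theorem aux_mono {x y : ℝ} (hx : 0 < x) (hy : x ≤ y) :
    Real.log (1 - Real.exp (-y)) - Real.log (1 - Real.exp (-x))
      ≤ x * (Real.exp x - 1)⁻¹ * (Real.log y - Real.log x) := by
  set r := x * (Real.exp x - 1)⁻¹ with hr
  have hpos : ∀ t : ℝ, x ≤ t → 0 < 1 - Real.exp (-t) := fun t ht => by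
    have : Real.exp (-t) < 1 := by
      rw [← Real.exp_zero]; exact Real.exp_lt_exp.2 (by linarith)
    linarith
  have hd : ∀ t : ℝ, x ≤ t → HasDerivAt
      (fun t => r * Real.log t - Real.log (1 - Real.exp (-t)))
      (r * t⁻¹ - (Real.exp t - 1)⁻¹) t := fun t ht => by
    have ht0 : 0 < t := hx.trans_le ht
    have h1 := (Real.hasDerivAt_log ht0.ne').const_mul r
    have h2 : HasDerivAt (fun t : ℝ => 1 - Real.exp (-t)) (Real.exp (-t)) t := by
      have := ((hasDerivAt_neg t).exp).const_sub 1
      simpa using this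
    have h3 := h2.log (hpos t ht).ne'
    have h4 := h1.sub h3
    have het : 0 < Real.exp t - 1 := by linarith [Real.add_one_lt_exp ht0.ne']
    have hp := hpos t ht
    have e : (Real.exp t - 1)⁻¹ = Real.exp (-t) / (1 - Real.exp (-t)) := by
      rw [eq_div_iff hp.ne', Real.exp_neg]
      have := Real.exp_pos t
      field_simp
    rw [e]
    exact h4
  have hm : MonotoneOn (fun t => r * Real.log t - Real.log (1 - Real.exp (-t))) (Set.Ici x) := by
    apply monotoneOn_of_deriv_nonneg (convex_Ici x)
    · exact fun t ht => (hd t ht).continuousAt.continuousWithinAt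
    · intro t ht
      rw [interior_Ici] at ht
      exact (hd t (le_of_lt ht)).differentiableAt.differentiableWithinAt
    · intro t ht
      rw [interior_Ici] at ht
      rw [(hd t (le_of_lt ht)).deriv]
      linarith [aux_secant hx (le_of_lt ht)]
  have := hm (Set.mem_Ici.2 le_rfl) (Set.mem_Ici.2 hy) hy
  simp only at this
  linarith

theorem aux_point {n α : ℝ} (hn : 0 < n) (hα : 0 ≤ α) :
    Real.log (1 - Real.exp (-(n * Real.sqrt (n ^ 2 + α))))
      ≤ Real.log (1 - Real.exp (-n ^ 2)) + (α / 2) * (Real.exp (n ^ 2) - 1)⁻¹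
        - (1 / 2) * (α / n ^ 2 - Real.log (1 + α / n ^ 2)) + 1 / 2 * α ^ 2 * (n ^ 2)⁻¹ := by
  have hx : 0 < n ^ 2 := by positivity
  have hs : n ≤ Real.sqrt (n ^ 2 + α) := Real.le_sqrt_of_sq_le (by linarith)
  have hs0 : 0 < Real.sqrt (n ^ 2 + α) := hn.trans_le hs
  have hy : n ^ 2 ≤ n * Real.sqrt (n ^ 2 + α) := by nlinarith
  have h1 := aux_mono hx hy
  have hl : Real.log (n * Real.sqrt (n ^ 2 + α)) - Real.log (n ^ 2)
      = 1 / 2 * Real.log (1 + α / n ^ 2) := by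
    have e : 1 + α / n ^ 2 = (n ^ 2 + α) / n ^ 2 := by field_simp
    rw [e, Real.log_div (by positivity) (by positivity), Real.log_mul hn.ne' hs0.ne',
      Real.log_sqrt (by positivity), Real.log_pow]
    push_cast
    ring
  rw [hl] at h1
  generalize n * Real.sqrt (n ^ 2 + α) = y at *
  generalize n ^ 2 = x at *
  have hex : 0 < Real.exp x - 1 := by linarith [Real.add_one_lt_exp hx.ne']
  set q := (Real.exp x - 1)⁻¹ with hq
  -- bounds on m = 1 - x q
  have hm0 : 0 ≤ 1 - x * q := by
    have : x * q ≤ 1 := by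
      rw [hq, ← div_eq_mul_inv, div_le_one hex]
      linarith [Real.add_one_le_exp x]
    linarith
  have hm1 : 1 - x * q ≤ x := by
    have hE : Real.exp x * (1 - x) ≤ 1 := by
      have := Real.add_one_le_exp (-x)
      have h2 := Real.exp_pos x
      have h3 : Real.exp x * Real.exp (-x) = 1 := by rw [← Real.exp_add]; simp
      nlinarith
    have : 1 - x ≤ x * q := by
      rw [hq, ← div_eq_mul_inv, le_div_iff₀ hex]
      linarith
    linarith
  have hsn : 0 ≤ α / x := by positivity
  have hlog : α / x - Real.log (1 + α / x) ≤ (α / x) ^ 2 := by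
    have h := Real.one_sub_inv_le_log_of_pos (show 0 < 1 + α / x by positivity)
    generalize α / x = s at *
    have : s - s ^ 2 ≤ 1 - (1 + s)⁻¹ := by
      have e : 1 - (1 + s)⁻¹ = s / (1 + s) := by field_simp; ring
      rw [e, le_div_iff₀ (by linarith)]
      nlinarith [pow_nonneg hsn 3]
    linarith
  have hA : (1 - x * q) * (α / x - Real.log (1 + α / x)) ≤ x * (α / x) ^ 2 :=
    (mul_le_mul_of_nonneg_left hlog hm0).trans (mul_le_mul_of_nonneg_right hm1 (by positivity))
  have e1 : x * (α / x) ^ 2 = α ^ 2 * x⁻¹ := by field_simp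
  have e2 : x * q * (α / x) = α * q := by field_simp
  rw [e1] at hA
  linear_combination h1 + 1 / 2 * hA + 1 / 2 * e2

theorem stmt_11 :
    ∃ C : ℝ, 0 < C ∧
      ∀ S : Finset (EuclideanSpace ℝ (Fin 3)), (∀ p ∈ S, p ≠ 0) →
      ∀ α : ℝ, 0 ≤ α →
        (∑ p ∈ S, Real.log (1 - Real.exp (-(‖p‖ * Real.sqrt (‖p‖ ^ 2 + α)))))
          ≤ (∑ p ∈ S, Real.log (1 - Real.exp (-‖p‖ ^ 2)))
            + (α / 2) * ∑ p ∈ S, (Real.exp (‖p‖ ^ 2) - 1)⁻¹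
            - (1 / 2) * ∑ p ∈ S, (α / ‖p‖ ^ 2 - Real.log (1 + α / ‖p‖ ^ 2))
            + C * α ^ 2 * ∑ p ∈ S, (‖p‖ ^ 2)⁻¹ := by
  refine ⟨1 / 2, by norm_num, fun S hS α hα => ?_⟩
  rw [Finset.mul_sum, Finset.mul_sum, Finset.mul_sum, ← Finset.sum_add_distrib,
    ← Finset.sum_sub_distrib, ← Finset.sum_add_distrib]
  exact Finset.sum_le_sum fun p hp => aux_point (norm_pos_iff.2 (hS p hp)) hα
end
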